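/- Let A : (0,∞) → ℝ be measurable with ∫₀^∞ (A(√(2r)))² e^{-r} dr < ∞. For nonnegative integers m, n define C_{m,n} = (1/(2π√(m! n!))) ∫_{ℝ²} A(√(x₁² + x₂²)) H_m(x₁) H_n(x₂) e^{-(x₁²+x₂²)/2} dx₁ dx₂. Then C_{m,n} = 0 whenever m or n is odd, and for m, n both even, C_{m,n} = h_m · h_n · ∫₀^∞ A(√(2u)) L_{(m+n)/2}(u) e^{-u} du. -/

import Mathlib

open MeasureTheory Real

/-- The Laguerre polynomial of degree `k`, `L_k(u) = ∑_{i=0}^k C(k,i) (-u)^i / i!`. -/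
noncomputable def laguerre (k : ℕ) (u : ℝ) : ℝ :=
  ∑ i ∈ Finset.range (k + 1), (k.choose i : ℝ) * (-u) ^ i / (Nat.factorial i : ℝ)

/-- The probabilists' Hermite polynomial `H_m`, evaluated at a real number. -/
noncomputable def hermiteFun (m : ℕ) (x : ℝ) : ℝ :=
  Polynomial.aeval x (Polynomial.hermite m)

/-- The constant `h_m = (-1)^{m/2} √(m!) / (2^{m/2} (m/2)!)` (for even `m`). -/
noncomputable def hCoef (m : ℕ) : ℝ :=
  (-1) ^ (m / 2) * Real.sqrt (Nat.factorial m) /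
    (2 ^ (m / 2) * (Nat.factorial (m / 2) : ℝ))

open Polynomial in
lemma hermiteFun_succ_succ (m : ℕ) (x : ℝ) :
    hermiteFun (m + 2) x = x * hermiteFun (m + 1) x - (m + 1) * hermiteFun m x ∧
    HasDerivAt (hermiteFun (m + 1)) ((m + 1) * hermiteFun m x) x := by
  have hd : ∀ m : ℕ, derivative (hermite (m + 1)) = ((m : ℤ[X]) + 1) * hermite m := by
    intro m
    induction m with
    | zero => simp
    | succ k ih =>
      have h2 : derivative (derivative (hermite (k + 1))) =
          ((k : ℤ[X]) + 1) * derivative (hermite k) := by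
        rw [ih]; simp [derivative_mul]
      rw [hermite_succ (k + 1), derivative_sub, derivative_mul, derivative_X, h2, ih]
      push_cast
      rw [hermite_succ k]; ring
  constructor
  · unfold hermiteFun
    rw [hermite_succ (m + 1), hd]
    simp
  · have := Polynomial.hasDerivAt_aeval (hermite (m + 1)) x
    rw [hd] at this
    refine HasDerivAt.congr_deriv (f := hermiteFun (m + 1)) this ?_
    simp [hermiteFun]

lemma hermiteFun_cont (m : ℕ) : Continuous (hermiteFun m) := by
  unfold hermiteFun; exact Polynomial.continuous_aeval _

lemma hermiteFun_sum (m : ℕ) (x : ℝ) : hermiteFun m x =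
    ∑ i ∈ Finset.range (m + 1), ((Polynomial.hermite m).coeff i : ℝ) * x ^ i := by
  unfold hermiteFun
  rw [Polynomial.aeval_eq_sum_range, Polynomial.natDegree_hermite]
  simp

lemma hermiteFun_neg_odd (m : ℕ) (hm : Odd m) (x : ℝ) :
    hermiteFun m (-x) = - hermiteFun m x := by
  rw [hermiteFun_sum, hermiteFun_sum, ← Finset.sum_neg_distrib]
  refine Finset.sum_congr rfl fun i _ => ?_
  rcases Nat.even_or_odd i with hi | hi
  · rw [Polynomial.coeff_hermite_of_odd_add (hm.add_even hi)]; simp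
  · rw [hi.neg_pow]; ring

lemma hermiteFun_bound (m : ℕ) : ∃ K : ℝ, 0 ≤ K ∧ ∀ x : ℝ,
    |hermiteFun m x| ≤ K * exp (x ^ 2 / 8) := by
  refine ⟨∑ i ∈ Finset.range (m + 1), |((Polynomial.hermite m).coeff i : ℝ)| *
    (Nat.factorial i * exp 2), by positivity, fun x => ?_⟩
  rw [hermiteFun_sum, Finset.sum_mul]
  refine (Finset.abs_sum_le_sum_abs _ _).trans (Finset.sum_le_sum fun i _ => ?_)
  rw [abs_mul, abs_pow, mul_assoc]
  refine mul_le_mul_of_nonneg_left ?_ (abs_nonneg _)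
  have h1 := Real.pow_div_factorial_le_exp |x| (abs_nonneg x) i
  rw [div_le_iff₀ (by positivity)] at h1
  have h2 : exp |x| ≤ exp 2 * exp (x ^ 2 / 8) := by
    rw [← exp_add, exp_le_exp]
    nlinarith [sq_nonneg (|x| - 4), sq_abs x]
  calc |x| ^ i ≤ exp |x| * Nat.factorial i := h1
    _ ≤ (exp 2 * exp (x ^ 2 / 8)) * Nat.factorial i := by gcongr
    _ = _ := by ring

/-- angular integral -/
noncomputable def angJ (m n : ℕ) (r : ℝ) : ℝ :=
  ∫ t in (-π)..π, hermiteFun m (r * cos t) * hermiteFun n (r * sin t)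

lemma angJ_rec (m n : ℕ) (r : ℝ) :
    ((n : ℝ) + 1) * angJ (m + 2) n r = ((m : ℝ) + 1) * angJ m (n + 2) r := by
  have hc := hermiteFun_cont
  have hder : ∀ t ∈ Set.uIcc (-π) π,
      HasDerivAt (fun t => hermiteFun (m + 1) (r * cos t) * hermiteFun (n + 1) (r * sin t))
      ((n + 1) * (hermiteFun (m + 2) (r * cos t) * hermiteFun n (r * sin t)) -
       (m + 1) * (hermiteFun m (r * cos t) * hermiteFun (n + 2) (r * sin t))) t := by
    intro t _
    have h1 := (hermiteFun_succ_succ m (r * cos t)).2.comp t ((hasDerivAt_cos t).const_mul r)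
    have h2 := (hermiteFun_succ_succ n (r * sin t)).2.comp t ((hasDerivAt_sin t).const_mul r)
    refine (h1.mul h2).congr_deriv ?_
    rw [(hermiteFun_succ_succ m (r * cos t)).1, (hermiteFun_succ_succ n (r * sin t)).1]
    simp only [Function.comp]
    ring
  have c1 : Continuous fun t => ((n : ℝ) + 1) *
      (hermiteFun (m + 2) (r * cos t) * hermiteFun n (r * sin t)) := by
    have := hc (m + 2); have := hc n; fun_prop
  have c2 : Continuous fun t => ((m : ℝ) + 1) *
      (hermiteFun m (r * cos t) * hermiteFun (n + 2) (r * sin t)) := by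
    have := hc m; have := hc (n + 2); fun_prop
  have := intervalIntegral.integral_eq_sub_of_hasDerivAt hder
    ((c1.sub c2).intervalIntegrable _ _)
  rw [intervalIntegral.integral_sub (c1.intervalIntegrable _ _) (c2.intervalIntegrable _ _),
    intervalIntegral.integral_const_mul, intervalIntegral.integral_const_mul] at this
  simp only [cos_neg, cos_pi, sin_neg, sin_pi, neg_zero, mul_zero, sub_self] at this
  unfold angJ
  linarith

lemma sin_moment (q : ℕ) : ∫ t in (-π)..π, sin t ^ (2 * q) =
    2 * π * Nat.factorial (2 * q) / (4 ^ q * (Nat.factorial q : ℝ) ^ 2) := by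
  induction q with
  | zero => simp; ring
  | succ k ih =>
    rw [show 2 * (k + 1) = 2 * k + 2 by ring, integral_sin_pow, ih]
    simp only [sin_neg, sin_pi, neg_zero]
    rw [Nat.factorial_succ (2 * k + 1), Nat.factorial_succ (2 * k), Nat.factorial_succ k]
    push_cast
    have : (Nat.factorial k : ℝ) ≠ 0 := by positivity
    field_simp
    ring

lemma hermite_coeff_real (i j : ℕ) : ((Polynomial.hermite (2 * (i + j))).coeff (2 * i) : ℝ) =
    (-1) ^ j * Nat.factorial (2 * (i + j)) /
      (2 ^ j * Nat.factorial j * Nat.factorial (2 * i)) := by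
  rw [show 2 * (i + j) = 2 * j + 2 * i by ring, Polynomial.coeff_hermite_explicit]
  push_cast
  have h1 : (Nat.doubleFactorial (2 * j - 1) : ℝ) * (2 ^ j * Nat.factorial j) =
      Nat.factorial (2 * j) := by
    rcases j with _ | j
    · simp
    · have := Nat.factorial_eq_mul_doubleFactorial (2 * j + 1)
      rw [show 2 * j + 1 + 1 = 2 * (j + 1) by ring, Nat.doubleFactorial_two_mul] at this
      rw [show 2 * (j + 1) - 1 = 2 * j + 1 by omega, this]
      push_cast; ring
  have h2 : ((2 * j + 2 * i).choose (2 * i) : ℝ) * Nat.factorial (2 * i) * Nat.factorial (2 * j) =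
      Nat.factorial (2 * j + 2 * i) := by
    have := Nat.add_choose_mul_factorial_mul_factorial (2 * j) (2 * i)
    rw [← this]; push_cast; ring
  rw [eq_div_iff (by positivity), ← h2, ← h1]
  ring

lemma angJ_zero (k : ℕ) (r : ℝ) : angJ 0 (2 * k) r =
    2 * π * ((-1) ^ k * Nat.factorial (2 * k) / (2 ^ k * Nat.factorial k)) *
      laguerre k (r ^ 2 / 2) := by
  have hs : ∀ x : ℝ, hermiteFun (2 * k) x = ∑ i ∈ Finset.range (k + 1),
      ((Polynomial.hermite (2 * k)).coeff (2 * i) : ℝ) * x ^ (2 * i) := by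
    intro x
    rw [hermiteFun_sum]
    symm
    refine Finset.sum_of_injOn (fun i => 2 * i) ?_ ?_ ?_ ?_
    · intro a _ b _ h; simpa using h
    · intro a ha; simp at ha ⊢; omega
    · intro i hi hn
      have : Odd i := by
        rw [← Nat.not_even_iff_odd]
        rintro ⟨j, rfl⟩
        apply hn
        simp at hi ⊢
        exact ⟨j, by omega, by omega⟩
      rw [Polynomial.coeff_hermite_of_odd_add ((even_two_mul k).add_odd this)]; simp
    · intro i _; rfl
  unfold angJ laguerre
  have h0 : ∀ x, hermiteFun 0 x = 1 := by intro x; simp [hermiteFun]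
  simp only [h0, one_mul, hs, mul_pow]
  rw [intervalIntegral.integral_finsetSum
    (fun i _ => Continuous.intervalIntegrable (by fun_prop) _ _), Finset.mul_sum]
  refine Finset.sum_congr rfl fun i hi => ?_
  obtain ⟨j, rfl⟩ := Nat.exists_eq_add_of_le (Nat.lt_succ_iff.mp (Finset.mem_range.mp hi))
  rw [intervalIntegral.integral_const_mul, intervalIntegral.integral_const_mul, sin_moment,
    hermite_coeff_real]
  have h2 : ((i + j).choose i : ℝ) * Nat.factorial i * Nat.factorial j =
      Nat.factorial (i + j) := by
    have := Nat.add_choose_mul_factorial_mul_factorial i j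
    rw [← this, Nat.choose_symm_add]; push_cast; ring
  have a1 : (Nat.factorial i : ℝ) ≠ 0 := by positivity
  have a2 : (Nat.factorial j : ℝ) ≠ 0 := by positivity
  have a3 : ((i + j).choose i : ℝ) ≠ 0 := by
    intro h; rw [h] at h2; simp at h2; exact absurd h2.symm (by positivity)
  rw [← h2, neg_pow (r ^ 2 / 2), div_pow, ← pow_mul, show (4 : ℝ) = 2 * 2 by norm_num, mul_pow,
    pow_add, pow_add]
  have s : ((-1 : ℝ) ^ i) * (-1) ^ i = 1 := by rw [← mul_pow]; simp
  field_simp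
  linear_combination (-r ^ (2 * i)) * s

lemma angJ_even (a b : ℕ) (r : ℝ) : angJ (2 * a) (2 * b) r =
    2 * π * ((-1) ^ (a + b) * Nat.factorial (2 * a) * Nat.factorial (2 * b) /
      (2 ^ (a + b) * Nat.factorial a * Nat.factorial b)) * laguerre (a + b) (r ^ 2 / 2) := by
  induction a generalizing b with
  | zero => simp [angJ_zero]
  | succ a ih =>
    have h := angJ_rec (2 * a) (2 * b) r
    have h2 := ih (b + 1)
    rw [show 2 * (b + 1) = 2 * b + 2 by ring] at h2
    rw [h2] at h
    rw [show 2 * (a + 1) = 2 * a + 2 by ring]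
    have hp : (((2 * b : ℕ) : ℝ) + 1) ≠ 0 := by positivity
    apply mul_left_cancel₀ hp
    rw [h, show a + 1 + b = a + (b + 1) by ring]
    rw [Nat.factorial_succ (2 * b + 1), Nat.factorial_succ (2 * b), Nat.factorial_succ b,
      Nat.factorial_succ (2 * a + 1), Nat.factorial_succ (2 * a), Nat.factorial_succ a]
    push_cast
    have a1 : (Nat.factorial a : ℝ) ≠ 0 := by positivity
    have a2 : (Nat.factorial b : ℝ) ≠ 0 := by positivity
    field_simp
    ring

lemma sq_image : (fun r : ℝ => r ^ 2 / 2) '' Set.Ioi 0 = Set.Ioi 0 := by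
  ext u
  constructor
  · rintro ⟨r, hr, rfl⟩
    have : (0 : ℝ) < r := hr
    show (0 : ℝ) < _
    positivity
  · intro hu
    have hu : (0 : ℝ) < u := hu
    refine ⟨√(2 * u), Real.sqrt_pos.mpr (by positivity), ?_⟩
    simp only
    rw [Real.sq_sqrt (by positivity)]; ring

lemma sq_inj : Set.InjOn (fun r : ℝ => r ^ 2 / 2) (Set.Ioi 0) := by
  intro a ha b hb h
  have ha : (0 : ℝ) < a := ha
  have hb : (0 : ℝ) < b := hb
  simp only at h
  exact (sq_eq_sq₀ ha.le hb.le).mp (by linarith)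

lemma sq_deriv : ∀ x ∈ Set.Ioi (0 : ℝ),
    HasDerivWithinAt (fun r : ℝ => r ^ 2 / 2) x (Set.Ioi 0) x := by
  intro x _
  have := ((hasDerivAt_pow 2 x).div_const 2).hasDerivWithinAt (s := Set.Ioi 0)
  refine this.congr_deriv ?_
  simp

lemma cv_integral (g : ℝ → ℝ) :
    ∫ u in Set.Ioi (0 : ℝ), g u = ∫ r in Set.Ioi (0 : ℝ), r * g (r ^ 2 / 2) := by
  have := integral_image_eq_integral_abs_deriv_smul measurableSet_Ioi sq_deriv sq_inj g
  rw [sq_image] at this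
  rw [this]
  refine setIntegral_congr_fun measurableSet_Ioi fun r hr => ?_
  simp [abs_of_pos (show (0 : ℝ) < r from hr)]

lemma cv_integrable (g : ℝ → ℝ) (hg : IntegrableOn g (Set.Ioi 0)) :
    IntegrableOn (fun r => r * g (r ^ 2 / 2)) (Set.Ioi 0) := by
  have := integrableOn_image_iff_integrableOn_abs_deriv_smul measurableSet_Ioi sq_deriv sq_inj g
  rw [sq_image] at this
  refine (this.mp hg).congr_fun (fun r hr => ?_) measurableSet_Ioi
  simp [abs_of_pos (show (0 : ℝ) < r from hr)]

lemma sqrt_aux (r : ℝ) (hr : 0 < r) : √(2 * (r ^ 2 / 2)) = r := by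
  rw [show 2 * (r ^ 2 / 2) = r ^ 2 by ring, Real.sqrt_sq hr.le]

lemma polar_integrable (A : ℝ → ℝ) (hA : Measurable A)
    (hInt : IntegrableOn (fun r => (A (Real.sqrt (2 * r))) ^ 2 * Real.exp (-r))
      (Set.Ioi (0 : ℝ))) (m n : ℕ) :
    IntegrableOn (fun p : ℝ × ℝ => p.1 * (A p.1 * hermiteFun m (p.1 * cos p.2) *
      hermiteFun n (p.1 * sin p.2) * exp (-p.1 ^ 2 / 2))) (Set.Ioi 0 ×ˢ Set.Ioo (-π) π) := by
  obtain ⟨K, hK0, hK⟩ := hermiteFun_bound m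
  obtain ⟨L, hL0, hL⟩ := hermiteFun_bound n
  have i1 : IntegrableOn (fun r => r * (A r ^ 2 * exp (-r ^ 2 / 2))) (Set.Ioi 0) := by
    refine (cv_integrable _ hInt).congr_fun (fun r hr => ?_) measurableSet_Ioi
    simp only [sqrt_aux r hr, neg_div]
  have i2 : IntegrableOn (fun r : ℝ => r * exp (-(1 / 4) * r ^ 2)) (Set.Ioi 0) :=
    (integrable_mul_exp_neg_mul_sq (by norm_num)).integrableOn
  have i3 := (i1.add i2).const_mul (K * L)
  have i4 : Integrable (fun _ : ℝ => (1 : ℝ)) (volume.restrict (Set.Ioo (-π) π)) :=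
    integrable_const _
  have i5 := i3.mul_prod i4
  rw [IntegrableOn, Measure.volume_eq_prod, ← Measure.prod_restrict]
  have cm := (hermiteFun_cont m).measurable
  have cn := (hermiteFun_cont n).measurable
  refine i5.mono' (Measurable.aestronglyMeasurable (by fun_prop)) ?_
  rw [Measure.prod_restrict, ae_restrict_iff' (measurableSet_Ioi.prod measurableSet_Ioo)]
  refine Filter.Eventually.of_forall fun p hp => ?_
  have hr : 0 < p.1 := hp.1
  simp only [Pi.add_apply, mul_one, norm_mul, Real.norm_eq_abs, abs_of_pos hr, abs_exp]
  set r := p.1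
  have e1 : |hermiteFun m (r * cos p.2)| * |hermiteFun n (r * sin p.2)| ≤
      K * L * exp (r ^ 2 / 8) := by
    calc _ ≤ (K * exp ((r * cos p.2) ^ 2 / 8)) * (L * exp ((r * sin p.2) ^ 2 / 8)) := by
          gcongr
          · exact hK _
          · exact hL _
      _ = K * L * exp ((r * cos p.2) ^ 2 / 8 + (r * sin p.2) ^ 2 / 8) := by
          rw [exp_add]; ring
      _ = _ := by
          congr 2
          linear_combination r ^ 2 / 8 * (sin_sq_add_cos_sq p.2)
  have e2 : |A r| * exp (r ^ 2 / 8) ≤ A r ^ 2 + exp (r ^ 2 / 8) ^ 2 := by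
    nlinarith [sq_nonneg (|A r| - exp (r ^ 2 / 8)), sq_abs (A r), abs_nonneg (A r),
      exp_pos (r ^ 2 / 8), sq_nonneg (|A r| + exp (r ^ 2 / 8))]
  have e3 : exp (r ^ 2 / 8) ^ 2 * exp (-r ^ 2 / 2) = exp (-(1 / 4) * r ^ 2) := by
    rw [← exp_nat_mul, ← exp_add]; congr 1; push_cast; ring
  calc _ = r * exp (-r ^ 2 / 2) * |A r| *
        (|hermiteFun m (r * cos p.2)| * |hermiteFun n (r * sin p.2)|) := by ring
    _ ≤ r * exp (-r ^ 2 / 2) * |A r| * (K * L * exp (r ^ 2 / 8)) := by gcongr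
    _ = r * exp (-r ^ 2 / 2) * (K * L) * (|A r| * exp (r ^ 2 / 8)) := by ring
    _ ≤ r * exp (-r ^ 2 / 2) * (K * L) * (A r ^ 2 + exp (r ^ 2 / 8) ^ 2) := by gcongr
    _ = _ := by rw [← e3]; ring

lemma polar_eq (A : ℝ → ℝ) (hA : Measurable A)
    (hInt : IntegrableOn (fun r => (A (Real.sqrt (2 * r))) ^ 2 * Real.exp (-r))
      (Set.Ioi (0 : ℝ))) (m n : ℕ) :
    ∫ x : ℝ × ℝ, A (Real.sqrt (x.1 ^ 2 + x.2 ^ 2)) * hermiteFun m x.1 * hermiteFun n x.2 *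
        Real.exp (-(x.1 ^ 2 + x.2 ^ 2) / 2) =
    ∫ r in Set.Ioi (0 : ℝ), r * (A r * angJ m n r * exp (-r ^ 2 / 2)) := by
  rw [← integral_comp_polarCoord_symm]
  have ht : polarCoord.target = Set.Ioi (0 : ℝ) ×ˢ Set.Ioo (-π) π := rfl
  have e : ∫ p in polarCoord.target, p.1 • ((fun x : ℝ × ℝ => A (Real.sqrt (x.1 ^ 2 + x.2 ^ 2)) *
        hermiteFun m x.1 * hermiteFun n x.2 *
        Real.exp (-(x.1 ^ 2 + x.2 ^ 2) / 2)) (polarCoord.symm p)) =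
      ∫ p in Set.Ioi (0 : ℝ) ×ˢ Set.Ioo (-π) π, p.1 * (A p.1 * hermiteFun m (p.1 * cos p.2) *
      hermiteFun n (p.1 * sin p.2) * exp (-p.1 ^ 2 / 2)) := by
    rw [ht]
    refine setIntegral_congr_fun (measurableSet_Ioi.prod measurableSet_Ioo) fun p hp => ?_
    have hr : 0 < p.1 := hp.1
    have hs : (p.1 * cos p.2) ^ 2 + (p.1 * sin p.2) ^ 2 = p.1 ^ 2 := by
      linear_combination p.1 ^ 2 * (sin_sq_add_cos_sq p.2)
    simp only [polarCoord_symm_apply, hs, Real.sqrt_sq hr.le, smul_eq_mul]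
  refine e.trans ?_
  have hi := polar_integrable A hA hInt m n
  rw [Measure.volume_eq_prod] at hi ⊢
  rw [setIntegral_prod _ hi]
  refine setIntegral_congr_fun measurableSet_Ioi fun r hr => ?_
  simp only
  rw [angJ, intervalIntegral.integral_of_le (by linarith [pi_pos]), integral_Ioc_eq_integral_Ioo,
    ← integral_const_mul, ← integral_mul_const, ← integral_const_mul]
  refine setIntegral_congr_fun measurableSet_Ioo fun t _ => ?_
  ring

/-- Lemma 1 of the paper: the Hermite coefficients of `A(|x₁ + i x₂|)` vanish unless both
indices are even, in which case they are given by a Laguerre integral. -/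
theorem stmt0 (A : ℝ → ℝ) (hA : Measurable A)
    (hInt : IntegrableOn (fun r => (A (Real.sqrt (2 * r))) ^ 2 * Real.exp (-r))
      (Set.Ioi (0 : ℝ)))
    (m n : ℕ) (C : ℝ)
    (hC : C = (1 / (2 * π * Real.sqrt ((Nat.factorial m : ℝ) * (Nat.factorial n : ℝ)))) *
      ∫ x : ℝ × ℝ, A (Real.sqrt (x.1 ^ 2 + x.2 ^ 2)) * hermiteFun m x.1 * hermiteFun n x.2 *
        Real.exp (-(x.1 ^ 2 + x.2 ^ 2) / 2)) :
    (Odd m ∨ Odd n → C = 0) ∧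
    (Even m → Even n → C = hCoef m * hCoef n *
      ∫ u in Set.Ioi (0 : ℝ),
        A (Real.sqrt (2 * u)) * laguerre ((m + n) / 2) u * Real.exp (-u)) := by
  constructor
  · intro h
    rw [hC]
    refine mul_eq_zero_of_right _ ?_
    set F : ℝ × ℝ → ℝ := fun x => A (Real.sqrt (x.1 ^ 2 + x.2 ^ 2)) * hermiteFun m x.1 *
      hermiteFun n x.2 * Real.exp (-(x.1 ^ 2 + x.2 ^ 2) / 2) with hF
    rcases h with h | h
    · have mp : MeasurePreserving (Prod.map (fun x : ℝ => -x) (id : ℝ → ℝ)) (volume : Measure (ℝ × ℝ)) volume :=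
        (Measure.measurePreserving_neg (volume : Measure ℝ)).prod (MeasurePreserving.id _)
      have := mp.integral_comp
        ((MeasurableEquiv.neg ℝ).prodCongr (MeasurableEquiv.refl ℝ)).measurableEmbedding F
      have h2 : ∀ x : ℝ × ℝ, F (Prod.map (fun x : ℝ => -x) (id : ℝ → ℝ) x) = - F x := by
        intro x
        simp only [hF, Prod.map_fst, Prod.map_snd, id, neg_sq, hermiteFun_neg_odd m h]
        ring
      simp only [h2, integral_neg] at this
      linarith
    · have mp : MeasurePreserving (Prod.map (id : ℝ → ℝ) (fun x : ℝ => -x)) (volume : Measure (ℝ × ℝ)) volume :=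
        (MeasurePreserving.id _).prod (Measure.measurePreserving_neg (volume : Measure ℝ))
      have := mp.integral_comp
        ((MeasurableEquiv.refl ℝ).prodCongr (MeasurableEquiv.neg ℝ)).measurableEmbedding F
      have h2 : ∀ x : ℝ × ℝ, F (Prod.map (id : ℝ → ℝ) (fun x : ℝ => -x) x) = - F x := by
        intro x
        simp only [hF, Prod.map_fst, Prod.map_snd, id, neg_sq, hermiteFun_neg_odd n h]
        ring
      simp only [h2, integral_neg] at this
      linarith
  · intro hm hn
    obtain ⟨a, rfl⟩ := even_iff_two_dvd.mp hm
    obtain ⟨b, rfl⟩ := even_iff_two_dvd.mp hn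
    rw [hC, polar_eq A hA hInt,
      cv_integral (fun u => A (√(2 * u)) * laguerre ((2 * a + 2 * b) / 2) u * exp (-u))]
    have e : ∀ r ∈ Set.Ioi (0 : ℝ), r * (A r * angJ (2 * a) (2 * b) r * exp (-r ^ 2 / 2)) =
        (2 * π * ((-1) ^ (a + b) * Nat.factorial (2 * a) * Nat.factorial (2 * b) /
        (2 ^ (a + b) * Nat.factorial a * Nat.factorial b))) *
        (r * (A (√(2 * (r ^ 2 / 2))) * laguerre ((2 * a + 2 * b) / 2) (r ^ 2 / 2) *
          exp (-(r ^ 2 / 2)))) := by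
      intro r hr
      rw [sqrt_aux r hr, angJ_even, show (2 * a + 2 * b) / 2 = a + b by omega, neg_div]
      ring
    rw [setIntegral_congr_fun measurableSet_Ioi e, integral_const_mul, ← mul_assoc]
    congr 1
    unfold hCoef
    rw [show 2 * a / 2 = a by omega, show 2 * b / 2 = b by omega,
      Real.sqrt_mul (by positivity)]
    have p1 : 0 < √(Nat.factorial (2 * a) : ℝ) := Real.sqrt_pos.mpr (by positivity)
    have p2 : 0 < √(Nat.factorial (2 * b) : ℝ) := Real.sqrt_pos.mpr (by positivity)
    have q1 : √(Nat.factorial (2 * a) : ℝ) ^ 2 = Nat.factorial (2 * a) :=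
      Real.sq_sqrt (by positivity)
    have q2 : √(Nat.factorial (2 * b) : ℝ) ^ 2 = Nat.factorial (2 * b) :=
      Real.sq_sqrt (by positivity)
    have a1 : (Nat.factorial a : ℝ) ≠ 0 := by positivity
    have a2 : (Nat.factorial b : ℝ) ≠ 0 := by positivity
    have := pi_pos
    generalize √(Nat.factorial (2 * a) : ℝ) = s at *
    generalize √(Nat.factorial (2 * b) : ℝ) = t at *
    rw [← q1, ← q2, pow_add, pow_add]
    field_simp
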